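/- arXiv:1601.03259 — 5 statements merged into one kernel-verified Lean document; each statement's English description precedes it below -/
import Mathlib

section
/- (Poincaré's theorem for 1-forms.) Let A and B be real Banach spaces and let U ⊆ A be an open set that is starlike with respect to a point a ∈ U. Let ω : A → L(A,B) be continuously differentiable on U. If dω = 0 on U, i.e. for every x ∈ U and all a₁, a₂ ∈ A one has (Dω(x)(a₁))(a₂) = (Dω(x)(a₂))(a₁), then ω is integrable on U: there exists a map f : A → B such that for every x ∈ U, f is Fréchet differentiable at x with Df(x) = ω(x). -/
/-- Poincaré's theorem for 1-forms: if `U` is an open set of a real Banach space `A`,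
starlike with respect to `a ∈ U`, and `ω : A → L(A,B)` is continuously differentiable on
`U` with symmetric derivative (`dω = 0`), then `ω` is integrable on `U`: there is
`f : A → B` with `Df(x) = ω(x)` for every `x ∈ U`. -/
theorem stmt_14 {A B : Type*} [NormedAddCommGroup A] [NormedSpace ℝ A] [CompleteSpace A]
    [NormedAddCommGroup B] [NormedSpace ℝ B] [CompleteSpace B]
    (U : Set A) (hU : IsOpen U) (a : A) (haU : a ∈ U)
    (hstar : ∀ x ∈ U, ∀ t ∈ Set.Icc (0 : ℝ) 1, a + t • (x - a) ∈ U)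
    (ω : A → (A →L[ℝ] B)) (ω' : A → (A →L[ℝ] (A →L[ℝ] B)))
    (hω : ∀ x ∈ U, HasFDerivAt ω (ω' x) x)
    (hω' : ContinuousOn ω' U)
    (hclosed : ∀ x ∈ U, ∀ a₁ a₂ : A, ω' x a₁ a₂ = ω' x a₂ a₁) :
    ∃ f : A → B, ∀ x ∈ U, HasFDerivAt f (ω x) x := by
  refine ⟨fun x ↦ curveIntegral ω (.segment a x), fun x hx ↦ ?_⟩
  obtain ⟨ε, hε, hball⟩ := Metric.isOpen_iff.1 hU x hx
  -- The cone with apex `a` over a small ball around `x` is a convex subset of `U`.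
  set s : Set A := convexJoin ℝ {a} (Metric.ball x ε)
  have hconv : Convex ℝ s := (convex_singleton a).convexJoin (convex_ball x ε)
  have hsub : s ⊆ U := by
    intro z hz
    obtain ⟨_, rfl, y, hy, hz⟩ := mem_convexJoin.1 hz
    rw [segment_eq_image'] at hz
    obtain ⟨t, ht, rfl⟩ := hz
    exact hstar y (hball hy) t ht
  have ha : a ∈ s := subset_convexJoin_left ⟨x, Metric.mem_ball_self hε⟩ rfl
  have hxs : s ∈ nhds x :=
    Filter.mem_of_superset (Metric.ball_mem_nhds x hε)
      (subset_convexJoin_right (Set.singleton_nonempty a))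
  exact (hconv.hasFDerivWithinAt_curveIntegral_segment_of_hasFDerivWithinAt_symmetric
    (fun y hy ↦ (hω y (hsub hy)).hasFDerivWithinAt)
    (fun y hy u _ v _ ↦ hclosed y (hsub hy) u v) ha (mem_of_mem_nhds hxs)).hasFDerivAt hxs
end

section
/- (Poincaré's theorem for p-forms.) Let A and B be real Banach spaces and let U ⊆ A be an open set that is starlike with respect to a point a ∈ U. Let p ≥ 1 and let ω be a continuously differentiable map on U from A into the Banach space of continuous alternating p-linear maps A^p → B. If dω = 0 on U, i.e. for every x ∈ U and all a₀,…,aₚ ∈ A, Σ_{i=0}^{p} (−1)^i·(Dω(x)(aᵢ))(a₀,…,âᵢ,…,aₚ) = 0, then ω is integrable on U: there exists a map α from A into the space of continuous alternating (p−1)-linear maps A^{p−1} → B, Fréchet differentiable at every point of U, such that for every x ∈ U and all a₀,…,a_{p−1} ∈ A, ω(x)(a₀,…,a_{p−1}) = Σ_{i=0}^{p−1} (−1)^i·(Dα(x)(aᵢ))(a₀,…,âᵢ,…,a_{p−1}). -/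
section StarlikeIntegral

open MeasureTheory Set Filter Topology

variable {A G : Type*} [NormedAddCommGroup A] [NormedSpace ℝ A]
  [NormedAddCommGroup G] [NormedSpace ℝ G]

/-- The weighted average `∫₀¹ tᵐ F (a + t (x - a)) dt` of `F` over the segment from `a` to `x`. -/
noncomputable def segmentIntegral (m : ℕ) (a : A) (F : A → G) (x : A) : G :=
  ∫ t in (0 : ℝ)..1, t ^ m • F (a + t • (x - a))

theorem continuousOn_segment_integrand {U : Set A} {a : A}
    (hstar : ∀ x ∈ U, ∀ t ∈ Icc (0 : ℝ) 1, a + t • (x - a) ∈ U)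
    {F : A → G} (hF : ContinuousOn F U) (m : ℕ) {x : A} (hx : x ∈ U) :
    ContinuousOn (fun t : ℝ => t ^ m • F (a + t • (x - a))) (Icc 0 1) :=
  (continuous_pow m).continuousOn.smul
    (hF.comp (by fun_prop) fun t ht => hstar x hx t ht)

theorem intervalIntegrable_segment_integrand {U : Set A} {a : A}
    (hstar : ∀ x ∈ U, ∀ t ∈ Icc (0 : ℝ) 1, a + t • (x - a) ∈ U)
    {F : A → G} (hF : ContinuousOn F U) (m : ℕ) {x : A} (hx : x ∈ U) :
    IntervalIntegrable (fun t : ℝ => t ^ m • F (a + t • (x - a))) volume 0 1 :=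
  (continuousOn_segment_integrand hstar hF m hx).intervalIntegrable_of_Icc zero_le_one

/-- Near `x`, a continuous function is uniformly bounded on the segments issued from `a`. -/
theorem exists_bound_on_segments {U : Set A} (hU : IsOpen U) {a : A}
    (hstar : ∀ x ∈ U, ∀ t ∈ Icc (0 : ℝ) 1, a + t • (x - a) ∈ U)
    {E : Type*} [NormedAddCommGroup E] {F : A → E} (hF : ContinuousOn F U) {x : A} (hx : x ∈ U) :
    ∃ C : ℝ, ∀ᶠ y in 𝓝 x, ∀ t ∈ Icc (0 : ℝ) 1, ‖F (a + t • (y - a))‖ ≤ C := by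
  obtain ⟨C, hC⟩ := isCompact_Icc.exists_bound_of_continuousOn
    (hF.comp (g := F) (f := fun t : ℝ => a + t • (x - a)) (s := Icc 0 1) (by fun_prop)
      fun t ht => hstar x hx t ht)
  refine ⟨C + 1, isCompact_Icc.eventually_forall_of_forall_eventually fun t ht => ?_⟩
  have hcont : ContinuousAt (fun z : A × ℝ => ‖F (a + z.2 • (z.1 - a))‖) (x, t) := by
    have hFt : ContinuousAt F (a + t • (x - a)) := hF.continuousAt (hU.mem_nhds (hstar x hx t ht))
    exact (ContinuousAt.comp (g := F) (f := fun z : A × ℝ => a + z.2 • (z.1 - a)) (x := (x, t))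
      hFt (by fun_prop)).norm
  filter_upwards [hcont.eventually_lt_const
    (show ‖F (a + t • (x - a))‖ < C + 1 by have := hC t ht; simp at this; linarith)] with z hz
  exact hz.le

theorem hasFDerivAt_segmentIntegral {U : Set A} (hU : IsOpen U) {a : A}
    (hstar : ∀ x ∈ U, ∀ t ∈ Icc (0 : ℝ) 1, a + t • (x - a) ∈ U)
    {F : A → G} {F' : A → A →L[ℝ] G} (hF : ∀ x ∈ U, HasFDerivAt F (F' x) x)
    (hF' : ContinuousOn F' U) (m : ℕ) {x : A} (hx : x ∈ U) :
    HasFDerivAt (segmentIntegral m a F) (segmentIntegral (m + 1) a F' x) x := by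
  have hFc : ContinuousOn F U := fun y hy => (hF y hy).continuousAt.continuousWithinAt
  have hsub : uIoc (0 : ℝ) 1 ⊆ Icc 0 1 := by
    rw [uIoc_of_le zero_le_one]; exact Ioc_subset_Icc_self
  obtain ⟨C, hC⟩ := exists_bound_on_segments hU hstar hF' hx
  have hs := inter_mem hC (hU.mem_nhds hx)
  refine intervalIntegral.hasFDerivAt_integral_of_dominated_of_fderiv_le
    (F := fun y (t : ℝ) => t ^ m • F (a + t • (y - a)))
    (F' := fun y (t : ℝ) => t ^ (m + 1) • F' (a + t • (y - a)))
    (bound := fun _ => C) hs ?_ (intervalIntegrable_segment_integrand hstar hFc m hx) ?_ ?_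
    intervalIntegrable_const ?_
  · filter_upwards [hU.mem_nhds hx] with y hy
    exact ((continuousOn_segment_integrand hstar hFc m hy).mono hsub).aestronglyMeasurable
      measurableSet_uIoc
  · exact ((continuousOn_segment_integrand hstar hF' (m + 1) hx).mono hsub).aestronglyMeasurable
      measurableSet_uIoc
  · refine Eventually.of_forall fun t ht y hy => ?_
    have ht' := hsub ht
    rw [norm_smul, norm_pow, Real.norm_of_nonneg ht'.1]
    exact (mul_le_of_le_one_left (norm_nonneg _) (pow_le_one₀ ht'.1 ht'.2)).trans (hy.1 t ht')
  · refine Eventually.of_forall fun t ht y hy => ?_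
    have hline : HasFDerivAt (fun z : A => a + t • (z - a)) (t • ContinuousLinearMap.id ℝ A) y :=
      (((hasFDerivAt_id y).sub_const a).const_smul t).const_add a
    have := ((hF _ (hstar y hy.2 t (hsub ht))).comp y hline).const_smul (t ^ m)
    refine this.congr_fderiv ?_
    ext v
    simp [pow_succ, mul_smul]

/-- Euler-type identity: integrating the derivative of `t ↦ tᵐ⁺¹ F (a + t (x - a))`. -/
theorem segmentIntegral_fderiv_apply_add [CompleteSpace G] {U : Set A} {a : A}
    (hstar : ∀ x ∈ U, ∀ t ∈ Icc (0 : ℝ) 1, a + t • (x - a) ∈ U)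
    {F : A → G} {F' : A → A →L[ℝ] G} (hF : ∀ x ∈ U, HasFDerivAt F (F' x) x)
    (hF' : ContinuousOn F' U) (m : ℕ) {x : A} (hx : x ∈ U) :
    segmentIntegral (m + 1) a F' x (x - a) + (m + 1) • segmentIntegral m a F x = F x := by
  have hFc : ContinuousOn F U := fun y hy => (hF y hy).continuousAt.continuousWithinAt
  have hi := intervalIntegrable_segment_integrand hstar hFc m hx
  have hi' := intervalIntegrable_segment_integrand hstar hF' (m + 1) hx
  have hi'x : IntervalIntegrable
      (fun t : ℝ => (t ^ (m + 1) • F' (a + t • (x - a))) (x - a)) volume 0 1 :=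
    ((continuousOn_segment_integrand hstar hF' (m + 1) hx).clm_apply
      continuousOn_const).intervalIntegrable_of_Icc zero_le_one
  have hderiv : ∀ t ∈ uIcc (0 : ℝ) 1, HasDerivAt (fun t : ℝ => t ^ (m + 1) • F (a + t • (x - a)))
      ((t ^ (m + 1) • F' (a + t • (x - a))) (x - a) +
        ((m + 1 : ℕ) : ℝ) • t ^ m • F (a + t • (x - a))) t := by
    intro t ht
    rw [uIcc_of_le zero_le_one] at ht
    have hline : HasDerivAt (fun t : ℝ => a + t • (x - a)) (x - a) t := by
      simpa using ((hasDerivAt_id t).smul_const (x - a)).const_add a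
    have := (hasDerivAt_pow (m + 1) t).smul
      ((hF _ (hstar x hx t ht)).comp_hasDerivAt t hline)
    refine this.congr_deriv ?_
    simp [mul_smul]
  have hi_smul : IntervalIntegrable
      (fun t : ℝ => ((m + 1 : ℕ) : ℝ) • t ^ m • F (a + t • (x - a))) volume 0 1 := hi.smul _
  have key := intervalIntegral.integral_eq_sub_of_hasDerivAt hderiv
    (hi'x.add hi_smul)
  rw [intervalIntegral.integral_add hi'x hi_smul,
    intervalIntegral.integral_smul] at key
  simp only [one_pow, one_smul, zero_pow (Nat.succ_ne_zero m), zero_smul, sub_zero,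
    add_sub_cancel] at key
  rw [segmentIntegral, ContinuousLinearMap.intervalIntegral_apply hi', ← Nat.cast_smul_eq_nsmul ℝ]
  exact key

/-- A continuous linear map that kills the values of `F` on `U` kills its average. -/
theorem map_segmentIntegral_eq_zero [CompleteSpace G] {H : Type*} [NormedAddCommGroup H]
    [NormedSpace ℝ H] [CompleteSpace H] {U : Set A} {a : A}
    (hstar : ∀ x ∈ U, ∀ t ∈ Icc (0 : ℝ) 1, a + t • (x - a) ∈ U)
    {F : A → G} (hF : ContinuousOn F U) (L : G →L[ℝ] H) (hL : ∀ x ∈ U, L (F x) = 0)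
    (m : ℕ) {x : A} (hx : x ∈ U) : L (segmentIntegral m a F x) = 0 := by
  rw [segmentIntegral, ← L.intervalIntegral_comp_comm
    (intervalIntegrable_segment_integrand hstar hF m hx)]
  refine intervalIntegral.integral_zero_ae (Eventually.of_forall fun t ht => ?_)
  rw [uIoc_of_le zero_le_one] at ht
  rw [map_smul, hL _ (hstar x hx t (Ioc_subset_Icc_self ht)), smul_zero]

end StarlikeIntegral

section Alternating

variable {A B : Type*} [NormedAddCommGroup A] [NormedSpace ℝ A]
  [NormedAddCommGroup B] [NormedSpace ℝ B] {n : ℕ}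

/-- The alternating sum of the values of an alternating map with one argument moved to the front. -/
theorem ContinuousMultilinearMap.sum_neg_one_pow_smul_cons_succAbove
    (f : ContinuousMultilinearMap ℝ (fun _ : Fin (n + 1) => A) B)
    (hf : ∀ v : Fin (n + 1) → A, ∀ i j, v i = v j → i ≠ j → f v = 0) (b : Fin (n + 1) → A) :
    ∑ i : Fin (n + 1), ((-1 : ℤ) ^ (i : ℕ)) •
      f (Fin.cons (b i) fun j : Fin n => b (i.succAbove j)) = (n + 1) • f b := by
  let g : A [⋀^Fin (n + 1)]→ₗ[ℝ] B :=
    { f.toMultilinearMap with map_eq_zero_of_eq' := fun v i j h hij => hf v i j h hij }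
  have hterm (i : Fin (n + 1)) : ((-1 : ℤ) ^ (i : ℕ)) •
      f (Fin.cons (b i) fun j : Fin n => b (i.succAbove j)) = f b := by
    have h := g.map_insertNth i (b i) (i.removeNth b)
    rw [Fin.insertNth_self_removeNth] at h
    change f b = _ • f (Fin.cons (b i) (i.removeNth b)) at h
    rw [h]
    rfl
  simp [hterm]

end Alternating

/-- Poincaré's theorem for `p`-forms (`p = n + 1 ≥ 1`): if `U` is an open set of a real
Banach space `A`, starlike with respect to `a ∈ U`, and `ω` is a continuously
differentiable map on `U` from `A` into the Banach space of continuous alternating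
`p`-linear maps `A^p → B` (encoded as continuous multilinear maps each of which is
alternating) with `dω = 0` on `U`, then `ω` is integrable on `U`: there is a map `α`
into continuous alternating `(p-1)`-linear maps, differentiable on `U`, whose exterior
differential is `ω`. -/
theorem stmt_15 {A B : Type*} [NormedAddCommGroup A] [NormedSpace ℝ A] [CompleteSpace A]
    [NormedAddCommGroup B] [NormedSpace ℝ B] [CompleteSpace B]
    (n : ℕ) (U : Set A) (hU : IsOpen U) (a : A) (haU : a ∈ U)
    (hstar : ∀ x ∈ U, ∀ t ∈ Set.Icc (0 : ℝ) 1, a + t • (x - a) ∈ U)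
    (ω : A → ContinuousMultilinearMap ℝ (fun _ : Fin (n + 1) => A) B)
    (hωalt : ∀ x : A, ∀ v : Fin (n + 1) → A, ∀ i j : Fin (n + 1),
      v i = v j → i ≠ j → ω x v = 0)
    (ω' : A → (A →L[ℝ] ContinuousMultilinearMap ℝ (fun _ : Fin (n + 1) => A) B))
    (hω : ∀ x ∈ U, HasFDerivAt ω (ω' x) x)
    (hω' : ContinuousOn ω' U)
    (hclosed : ∀ x ∈ U, ∀ b : Fin (n + 2) → A,
      ∑ i : Fin (n + 2),
        ((-1 : ℤ) ^ (i : ℕ)) • (ω' x (b i)) (fun j : Fin (n + 1) => b (i.succAbove j)) = 0) :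
    ∃ α : A → ContinuousMultilinearMap ℝ (fun _ : Fin n => A) B,
      (∀ x : A, ∀ v : Fin n → A, ∀ i j : Fin n, v i = v j → i ≠ j → α x v = 0) ∧
      ∀ x ∈ U, DifferentiableAt ℝ α x ∧
        ∀ b : Fin (n + 1) → A,
          ω x b = ∑ i : Fin (n + 1),
            ((-1 : ℤ) ^ (i : ℕ)) •
              (fderiv ℝ α x (b i)) (fun j : Fin n => b (i.succAbove j)) := by
  let ev (k : ℕ) (v : Fin k → A) :=
    ContinuousMultilinearMap.apply ℝ (fun _ : Fin k => A) B v
  let curry := (continuousMultilinearCurryLeftEquiv ℝ (fun _ : Fin (n + 1) => A) B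
    ).toContinuousLinearEquiv.toContinuousLinearMap
  have hωc : ContinuousOn ω U := fun y hy => (hω y hy).continuousAt.continuousWithinAt
  let β : A → ContinuousMultilinearMap ℝ (fun _ : Fin (n + 1) => A) B := segmentIntegral n a ω
  let β' := segmentIntegral (n + 1) a ω'
  have hβalt : ∀ x ∈ U, ∀ v : Fin (n + 1) → A, ∀ i j, v i = v j → i ≠ j → β x v = 0 :=
    fun x hx v i j h hij => map_segmentIntegral_eq_zero hstar hωc (ev _ v)
      (fun y _ => hωalt y v i j h hij) n hx
  have hβclosed : ∀ x ∈ U, ∀ b : Fin (n + 2) → A,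
      ∑ i : Fin (n + 2),
        ((-1 : ℤ) ^ (i : ℕ)) • (β' x (b i)) (fun j : Fin (n + 1) => b (i.succAbove j)) = 0 := by
    intro x hx b
    let L : (A →L[ℝ] ContinuousMultilinearMap ℝ (fun _ : Fin (n + 1) => A) B) →L[ℝ] B :=
      ∑ i : Fin (n + 2), ((-1 : ℤ) ^ (i : ℕ)) •
        (ev _ fun j : Fin (n + 1) => b (i.succAbove j)).comp (ContinuousLinearMap.apply ℝ _ (b i))
    have hL (T) : L T = ∑ i : Fin (n + 2),
        ((-1 : ℤ) ^ (i : ℕ)) • (T (b i)) (fun j : Fin (n + 1) => b (i.succAbove j)) := by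
      simp [L, ev]
    rw [← hL]
    have hLω (y) (hy : y ∈ U) : L (ω' y) = 0 := (hL _).trans (hclosed y hy b)
    exact map_segmentIntegral_eq_zero (F := ω') hstar hω' L hLω (n + 1) hx
  have hα : ∀ x ∈ U, HasFDerivAt (fun y => curry (β y) (y - a))
      ((curry (β x)).comp (ContinuousLinearMap.id ℝ A) +
        (curry.comp (β' x)).flip (x - a)) x := fun x hx =>
    (curry.hasFDerivAt.comp x (hasFDerivAt_segmentIntegral hU hstar hω hω' n hx)).clm_apply
      ((hasFDerivAt_id x).sub_const a)
  refine ⟨U.indicator fun x => curry (β x) (x - a), fun x v i j h hij => ?_, fun x hx => ?_⟩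
  · by_cases hx : x ∈ U
    · rw [Set.indicator_of_mem hx]
      exact hβalt x hx (Fin.cons (x - a) v) i.succ j.succ (by simpa using h) (by simpa using hij)
    · simp [Set.indicator_of_notMem hx]
  · have hαx := (hα x hx).congr_of_eventuallyEq
      ((Set.eqOn_indicator (s := U)).eventuallyEq_of_mem (hU.mem_nhds hx))
    refine ⟨hαx.differentiableAt, fun b => ?_⟩
    rw [hαx.fderiv]
    have hEuler := DFunLike.congr_fun (segmentIntegral_fderiv_apply_add hstar hω hω' n hx) b
    have hsum := (β x).sum_neg_one_pow_smul_cons_succAbove (hβalt x hx) b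
    have hcl := hβclosed x hx (Fin.cons (x - a) b)
    rw [Fin.sum_univ_succ] at hcl
    have hsucc (i : Fin (n + 1)) : (fun j : Fin (n + 1) =>
        (Fin.cons (x - a) b : Fin (n + 2) → A) (i.succ.succAbove j)) =
        Fin.cons (x - a) fun j : Fin n => b (i.succAbove j) := by
      ext j
      refine Fin.cases ?_ (fun k => ?_) j <;> simp
    simp only [hsucc, Fin.cons_succ, Fin.cons_zero, Fin.val_zero, pow_zero, one_smul,
      Fin.val_succ, pow_succ, mul_neg, mul_one, neg_smul, Finset.sum_neg_distrib,
      Fin.zero_succAbove, add_neg_eq_zero] at hcl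
    calc ω x b = β' x (x - a) b + (n + 1) • β x b := hEuler.symm
      _ = _ := by
        rw [hcl, ← hsum, add_comm, ← Finset.sum_add_distrib]
        exact Finset.sum_congr rfl fun i _ => (smul_add _ _ _).symm
end

section
/- Let A and B be real Banach spaces and let U ⊆ A be an open set that is starlike with respect to a point a ∈ U. Let ω : A → L(A,B) be continuously differentiable on U. Then ω is integrable on U — that is, there exists f : A → B such that for every x ∈ U, f is Fréchet differentiable at x with Df(x) = ω(x) — if and only if dω = 0 on U, i.e. for every x ∈ U and all a₁, a₂ ∈ A, (Dω(x)(a₁))(a₂) = (Dω(x)(a₂))(a₁). -/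
open Set Filter Topology in
/-- If `g` is continuous on `U ×ˢ K` with `U` open and `K` compact, then `g` is bounded on `V ×ˢ K`
for some neighbourhood `V` of any given point of `U`. -/
theorem ContinuousOn.exists_eventually_forall_norm_le {X Y E : Type*} [TopologicalSpace X]
    [TopologicalSpace Y] [SeminormedAddCommGroup E] {U : Set X} {K : Set Y} (hU : IsOpen U)
    (hK : IsCompact K) {g : X × Y → E} (hg : ContinuousOn g (U ×ˢ K)) {x₀ : X} (hx₀ : x₀ ∈ U) :
    ∃ C : ℝ, ∀ᶠ x in 𝓝 x₀, ∀ y ∈ K, ‖g (x, y)‖ ≤ C := by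
  obtain ⟨C, hC⟩ := hK.exists_bound_of_continuousOn (f := fun y => g (x₀, y))
    (hg.comp (by fun_prop) fun y hy => ⟨hx₀, hy⟩)
  have key : ∀ᶠ x in 𝓝 x₀, ∀ y ∈ K, x ∈ U → y ∈ K → ‖g (x, y)‖ < C + 1 := by
    refine hK.eventually_forall_of_forall_eventually fun y hy => ?_
    have h := (hg (x₀, y) ⟨hx₀, hy⟩).norm.eventually_lt_const
      ((hC y hy).trans_lt (lt_add_one C))
    filter_upwards [eventually_nhdsWithin_iff.1 h] with z hz hz₁ hz₂ using hz ⟨hz₁, hz₂⟩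
  refine ⟨C + 1, ?_⟩
  filter_upwards [key, hU.mem_nhds hx₀] with x hx hxU y hy using (hx y hy hxU hy).le

open Set Filter Topology in
/-- **Poincaré lemma** for 1-forms on an open starlike set: the radial integral of a closed
continuously differentiable 1-form is a primitive of it. -/
theorem hasFDerivAt_integral_of_starlike_of_symmetric {A B : Type*}
    [NormedAddCommGroup A] [NormedSpace ℝ A]
    [NormedAddCommGroup B] [NormedSpace ℝ B] [CompleteSpace B]
    {U : Set A} (hU : IsOpen U) {a : A}
    (hstar : ∀ x ∈ U, ∀ t ∈ Icc (0 : ℝ) 1, a + t • (x - a) ∈ U)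
    {ω : A → (A →L[ℝ] B)} {ω' : A → (A →L[ℝ] (A →L[ℝ] B))}
    (hω : ∀ x ∈ U, HasFDerivAt ω (ω' x) x) (hω' : ContinuousOn ω' U)
    (hsymm : ∀ x ∈ U, ∀ a₁ a₂ : A, ω' x a₁ a₂ = ω' x a₂ a₁) {x₀ : A} (hx₀ : x₀ ∈ U) :
    HasFDerivAt (fun x => ∫ t in (0 : ℝ)..1, ω (a + t • (x - a)) (x - a)) (ω x₀) x₀ := by
  have hωc : ContinuousOn ω U := fun x hx => (hω x hx).continuousAt.continuousWithinAt
  set G : A × ℝ → (A →L[ℝ] B) := fun z =>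
    ω (a + z.2 • (z.1 - a)) + z.2 • ω' (a + z.2 • (z.1 - a)) (z.1 - a) with hG
  have hmaps : MapsTo (fun z : A × ℝ => a + z.2 • (z.1 - a)) (U ×ˢ Icc (0 : ℝ) 1) U :=
    fun z hz => hstar z.1 hz.1 z.2 hz.2
  have hpc : ContinuousOn (fun z : A × ℝ => a + z.2 • (z.1 - a)) (U ×ˢ Icc (0 : ℝ) 1) := by
    fun_prop
  have hGc : ContinuousOn G (U ×ˢ Icc (0 : ℝ) 1) :=
    (hωc.comp hpc hmaps).add (continuousOn_snd.smul
      ((hω'.comp hpc hmaps).clm_apply (continuousOn_fst.sub continuousOn_const)))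
  have hFc (x : A) (hx : x ∈ U) :
      ContinuousOn (fun t : ℝ => ω (a + t • (x - a)) (x - a)) (uIcc 0 1) := by
    rw [uIcc_of_le zero_le_one]
    exact (hωc.comp (by fun_prop) (hstar x hx)).clm_apply continuousOn_const
  have hGx₀ : ContinuousOn (fun t : ℝ => G (x₀, t)) (uIcc 0 1) := by
    rw [uIcc_of_le zero_le_one]
    exact hGc.comp (by fun_prop) fun t ht => ⟨hx₀, ht⟩
  obtain ⟨C, hC⟩ := hGc.exists_eventually_forall_norm_le hU isCompact_Icc hx₀
  have hsub : uIoc (0 : ℝ) 1 ⊆ Icc 0 1 := by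
    rw [uIoc_of_le zero_le_one]
    exact Ioc_subset_Icc_self
  have hFTC : ∫ t in (0 : ℝ)..1, G (x₀, t) = ω x₀ := by
    have hderiv : ∀ t ∈ uIcc (0 : ℝ) 1,
        HasDerivAt (fun t : ℝ => t • ω (a + t • (x₀ - a))) (G (x₀, t)) t := by
      intro t ht
      rw [uIcc_of_le zero_le_one] at ht
      have hline : HasDerivAt (fun t : ℝ => a + t • (x₀ - a)) (x₀ - a) t := by
        simpa using ((hasDerivAt_id t).smul_const (x₀ - a)).const_add a
      have h := (hasDerivAt_id t).smul ((hω _ (hstar x₀ hx₀ t ht)).comp_hasDerivAt t hline)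
      exact h.congr_deriv (by simp [hG, add_comm])
    rw [intervalIntegral.integral_eq_sub_of_hasDerivAt hderiv hGx₀.intervalIntegrable]
    simp
  rw [← hFTC]
  refine intervalIntegral.hasFDerivAt_integral_of_dominated_of_fderiv_le
    (F' := fun x t => G (x, t)) (bound := fun _ => C)
    (inter_mem hC (hU.mem_nhds hx₀)) ?_ (hFc x₀ hx₀).intervalIntegrable
    hGx₀.intervalIntegrable.def'.aestronglyMeasurable ?_ intervalIntegrable_const ?_
  · filter_upwards [hU.mem_nhds hx₀] with x hx
    exact (hFc x hx).intervalIntegrable.def'.aestronglyMeasurable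
  · exact .of_forall fun t ht x hx => hx.1 t (hsub ht)
  · refine .of_forall fun t ht x hx => ?_
    have hp := hstar x hx.2 t (hsub ht)
    have hid : HasFDerivAt (fun x : A => x - a) (ContinuousLinearMap.id ℝ A) x :=
      (hasFDerivAt_id x).sub_const a
    have h := ((hω _ hp).comp x ((hid.const_smul t).const_add a)).clm_apply hid
    refine h.congr_fderiv ?_
    ext v
    simp [hG, hsymm _ hp v]

/-- On an open set `U` of a real Banach space `A`, starlike with respect to `a ∈ U`, a
continuously differentiable 1-form `ω : A → L(A,B)` is integrable on `U` if and only if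
`dω = 0` on `U`, i.e. its derivative is symmetric at every point of `U`. -/
theorem stmt_16 {A B : Type*} [NormedAddCommGroup A] [NormedSpace ℝ A] [CompleteSpace A]
    [NormedAddCommGroup B] [NormedSpace ℝ B] [CompleteSpace B]
    (U : Set A) (hU : IsOpen U) (a : A) (haU : a ∈ U)
    (hstar : ∀ x ∈ U, ∀ t ∈ Set.Icc (0 : ℝ) 1, a + t • (x - a) ∈ U)
    (ω : A → (A →L[ℝ] B)) (ω' : A → (A →L[ℝ] (A →L[ℝ] B)))
    (hω : ∀ x ∈ U, HasFDerivAt ω (ω' x) x)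
    (hω' : ContinuousOn ω' U) :
    (∃ f : A → B, ∀ x ∈ U, HasFDerivAt f (ω x) x) ↔
      (∀ x ∈ U, ∀ a₁ a₂ : A, ω' x a₁ a₂ = ω' x a₂ a₁) := by
  refine ⟨fun ⟨f, hf⟩ x hx => second_derivative_symmetric_of_eventually
    (by filter_upwards [hU.mem_nhds hx] with y hy using hf y hy) (hω x hx), fun hsymm => ?_⟩
  exact ⟨_, fun x hx => hasFDerivAt_integral_of_starlike_of_symmetric hU hstar hω hω' hsymm hx⟩
end

section
/- Let A and B be real Banach spaces and let U ⊆ A be a nonempty open connected set. Let ω : A → L(A,B) be continuously differentiable on U. Then the following are equivalent: (1) ω is integrable on U, i.e. there exists f : A → B such that for every x ∈ U, f is Fréchet differentiable at x with Df(x) = ω(x); (2) for every loop γ of class C¹ contained in U — that is, every γ : ℝ → A with continuous derivative γ′ such that γ(t) ∈ U for all t ∈ [0,1] and γ(0) = γ(1) — one has ∫₀¹ ω(γ(t))(γ′(t)) dt = 0. -/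
/-- There is a `C¹` path in `U`, constantly `x` before time `0` and constantly `y` after time `1`,
along which the integral of `ω` is `v`. Such paths can be concatenated by adding them. -/
def HasPathIntegral {A B : Type*} [NormedAddCommGroup A] [NormedSpace ℝ A]
    [NormedAddCommGroup B] [NormedSpace ℝ B] (U : Set A) (ω : A → (A →L[ℝ] B))
    (x y : A) (v : B) : Prop :=
  ∃ γ γd : ℝ → A, (∀ t, HasDerivAt γ (γd t) t) ∧ Continuous γd ∧ (∀ t, γ t ∈ U) ∧
    (∀ t ≤ 0, γ t = x) ∧ (∀ t, 1 ≤ t → γ t = y) ∧ ∫ t in (0 : ℝ)..1, ω (γ t) (γd t) = v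

section

variable {A B : Type*} [NormedAddCommGroup A] [NormedSpace ℝ A]
  [NormedAddCommGroup B] [NormedSpace ℝ B] {U : Set A} {ω : A → (A →L[ℝ] B)}

theorem HasDerivAt.eq_zero_of_forall_le {γ : ℝ → A} {d x : A} {t a : ℝ}
    (h : HasDerivAt γ d t) (hx : ∀ s ≤ a, γ s = x) (ht : t ≤ a) : d = 0 :=
  (uniqueDiffOn_Iic a t ht).eq_deriv _ h.hasDerivWithinAt
    ((hasDerivWithinAt_const t (Set.Iic a) x).congr hx (hx t ht))

theorem HasDerivAt.eq_zero_of_forall_ge {γ : ℝ → A} {d x : A} {t a : ℝ}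
    (h : HasDerivAt γ d t) (hx : ∀ s, a ≤ s → γ s = x) (ht : a ≤ t) : d = 0 :=
  (uniqueDiffOn_Ici a t ht).eq_deriv _ h.hasDerivWithinAt
    ((hasDerivWithinAt_const t (Set.Ici a) x).congr hx (hx t ht))

theorem continuous_clm_apply_path (hω : ContinuousOn ω U) {γ γd : ℝ → A}
    (hγ : ∀ t, HasDerivAt γ (γd t) t) (hγd : Continuous γd) (hU : ∀ t, γ t ∈ U) :
    Continuous fun t => ω (γ t) (γd t) :=
  (hω.comp_continuous (continuous_iff_continuousAt.2 fun t => (hγ t).continuousAt) hU).clm_apply hγd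

theorem HasPathIntegral.symm {x y : A} {v : B} (h : HasPathIntegral U ω x y v) :
    HasPathIntegral U ω y x (-v) := by
  obtain ⟨γ, γd, hγ, hγd, hU, h0, h1, hv⟩ := h
  refine ⟨fun t => γ (1 - t), fun t => -γd (1 - t), fun t => ?_, by fun_prop, fun t => hU _,
    fun t ht => h1 _ (by linarith), fun t ht => h0 _ (by linarith), ?_⟩
  · simpa [Function.comp_def] using (hγ (1 - t)).scomp t ((hasDerivAt_id t).const_sub 1)
  · have := intervalIntegral.integral_comp_sub_left (a := 0) (b := 1)
      (fun t => ω (γ t) (γd t)) 1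
    simp only [sub_self, sub_zero] at this
    simp only [map_neg, intervalIntegral.integral_neg, this, hv]

theorem HasPathIntegral.trans (hω : ContinuousOn ω U) {x y z : A} {v w : B}
    (h : HasPathIntegral U ω x y v) (h' : HasPathIntegral U ω y z w) :
    HasPathIntegral U ω x z (v + w) := by
  obtain ⟨γ, γd, hγ, hγd, hU, h0, h1, hv⟩ := h
  obtain ⟨δ, δd, hδ, hδd, hU', h0', h1', hw⟩ := h'
  have hleft : ∀ t : ℝ, t ≤ 1 / 2 → γ (2 * t) + δ (2 * t - 1) - y = γ (2 * t) := fun t ht => by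
    rw [h0' _ (by linarith)]; abel
  have hright : ∀ t : ℝ, 1 / 2 ≤ t → γ (2 * t) + δ (2 * t - 1) - y = δ (2 * t - 1) :=
    fun t ht => by rw [h1 _ (by linarith)]; abel
  have hderiv : ∀ t : ℝ, HasDerivAt (fun t => γ (2 * t) + δ (2 * t - 1) - y)
      ((2 : ℝ) • γd (2 * t) + (2 : ℝ) • δd (2 * t - 1)) t := fun t => by
    have h2 : HasDerivAt (fun t : ℝ => 2 * t) 2 t := by
      simpa using (hasDerivAt_id t).const_mul 2
    exact (((hγ (2 * t)).scomp t h2).add ((hδ (2 * t - 1)).scomp t (h2.sub_const 1))).sub_const y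
  have hcont : Continuous fun t : ℝ => (2 : ℝ) • γd (2 * t) + (2 : ℝ) • δd (2 * t - 1) := by
    fun_prop
  have hmem : ∀ t : ℝ, γ (2 * t) + δ (2 * t - 1) - y ∈ U := fun t => by
    rcases le_total t (1 / 2) with ht | ht
    · rw [hleft t ht]; exact hU _
    · rw [hright t ht]; exact hU' _
  have hint := continuous_clm_apply_path hω hderiv hcont hmem
  refine ⟨_, _, hderiv, hcont, hmem, fun t ht => ?_, fun t ht => ?_, ?_⟩
  · rw [hleft t (by linarith), h0 _ (by linarith)]
  · rw [hright t (by linarith), h1' _ (by linarith)]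
  · rw [← intervalIntegral.integral_add_adjacent_intervals
      (hint.intervalIntegrable 0 (1 / 2)) (hint.intervalIntegrable (1 / 2) 1)]
    congr 1
    · have := intervalIntegral.smul_integral_comp_mul_left (a := 0) (b := 1 / 2)
        (fun t => ω (γ t) (γd t)) 2
      norm_num at this
      rw [← hv, ← this, ← intervalIntegral.integral_smul]
      refine intervalIntegral.integral_congr fun t ht => ?_
      rw [Set.uIcc_of_le (by norm_num)] at ht
      simp only [hleft t ht.2,
        (hδ (2 * t - 1)).eq_zero_of_forall_le h0' (by linarith [ht.2]), smul_zero, add_zero,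
        map_smul]
    · have := intervalIntegral.smul_integral_comp_mul_sub (a := 1 / 2) (b := 1)
        (fun t => ω (δ t) (δd t)) 2 1
      norm_num at this
      rw [← hw, ← this, ← intervalIntegral.integral_smul]
      refine intervalIntegral.integral_congr fun t ht => ?_
      rw [Set.uIcc_of_le (by norm_num)] at ht
      simp only [hright t ht.1,
        (hγ (2 * t)).eq_zero_of_forall_ge h1 (by linarith [ht.1]), smul_zero, zero_add,
        map_smul]

theorem exists_hasPathIntegral_norm_sub_le [CompleteSpace B] (hω : ContinuousOn ω U) :
    ∃ C > 0, ∀ (x : A) (r ε : ℝ), Metric.ball x r ⊆ U →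
      (∀ z ∈ Metric.ball x r, ‖ω z - ω x‖ ≤ ε) → ∀ y ∈ Metric.ball x r,
      ∃ v, HasPathIntegral U ω x y v ∧ ‖v - ω x (y - x)‖ ≤ ε * (C * ‖y - x‖) := by
  have hs : ContDiff ℝ 1 Real.smoothTransition := Real.smoothTransition.contDiff
  have hds : Continuous (deriv Real.smoothTransition) := hs.continuous_deriv le_rfl
  have hsd : ∀ t, HasDerivAt Real.smoothTransition (deriv Real.smoothTransition t) t := fun t =>
    (hs.differentiable one_ne_zero t).hasDerivAt
  obtain ⟨C, hC⟩ := isCompact_Icc.exists_bound_of_continuousOn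
    (hds.continuousOn (s := Set.Icc (0 : ℝ) 1))
  refine ⟨max C 1, by positivity, fun x r ε hr hε y hy => ?_⟩
  have hball : ∀ t, x + Real.smoothTransition t • (y - x) ∈ Metric.ball x r := fun t => by
    rw [mem_ball_iff_norm] at hy ⊢
    rw [add_sub_cancel_left, norm_smul, Real.norm_of_nonneg (Real.smoothTransition.nonneg t)]
    exact (mul_le_of_le_one_left (norm_nonneg _) (Real.smoothTransition.le_one t)).trans_lt hy
  have hderiv : ∀ t, HasDerivAt (fun t => x + Real.smoothTransition t • (y - x))
      (deriv Real.smoothTransition t • (y - x)) t := fun t =>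
    ((hsd t).smul_const (y - x)).const_add x
  have hcont : Continuous fun t => deriv Real.smoothTransition t • (y - x) := by fun_prop
  have hint := continuous_clm_apply_path hω hderiv hcont fun t => hr (hball t)
  refine ⟨_, ⟨_, _, hderiv, hcont, fun t => hr (hball t), fun t ht => ?_, fun t ht => ?_, rfl⟩, ?_⟩
  · simp [Real.smoothTransition.zero_of_nonpos ht]
  · simp [Real.smoothTransition.one_of_one_le ht]
  · have hconst : ∫ t in (0 : ℝ)..1, ω x (deriv Real.smoothTransition t • (y - x))
        = ω x (y - x) := by
      simp only [map_smul]
      rw [intervalIntegral.integral_smul_const,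
        intervalIntegral.integral_eq_sub_of_hasDerivAt (fun t _ => hsd t)
          (hds.intervalIntegrable 0 1)]
      simp
    rw [← hconst, ← intervalIntegral.integral_sub (hint.intervalIntegrable 0 1)
      (Continuous.intervalIntegrable (by fun_prop) 0 1)]
    refine (intervalIntegral.norm_integral_le_of_norm_le_const fun t ht => ?_).trans_eq
      (by rw [sub_zero, abs_one, mul_one])
    rw [Set.uIoc_of_le zero_le_one] at ht
    rw [← sub_apply]
    refine (ContinuousLinearMap.le_opNorm _ _).trans ?_
    rw [norm_smul]
    gcongr
    · exact (norm_nonneg _).trans (hε _ (hball t))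
    · exact hε _ (hball t)
    · exact (hC t (Set.Ioc_subset_Icc_self ht)).trans (le_max_left _ _)

theorem exists_hasFDerivAt_of_hasPathIntegral_eq_zero [CompleteSpace B] (hU : IsOpen U)
    (hconn : IsConnected U) (hω : ContinuousOn ω U)
    (hloop : ∀ x v, HasPathIntegral U ω x x v → v = 0) :
    ∃ f : A → B, ∀ x ∈ U, HasFDerivAt f (ω x) x := by
  obtain ⟨C, hC, hseg⟩ := exists_hasPathIntegral_norm_sub_le hω
  have hlocal : ∀ x ∈ U, ∀ ε > 0, ∀ᶠ y in nhds x,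
      ∃ v, HasPathIntegral U ω x y v ∧ ‖v - ω x (y - x)‖ ≤ ε * (C * ‖y - x‖) := by
    intro x hx ε hε
    have hnear : ∀ᶠ z in nhds x, z ∈ U ∧ ‖ω z - ω x‖ ≤ ε := by
      filter_upwards [hU.mem_nhds hx, (hω.continuousAt (hU.mem_nhds hx)).eventually
        (Metric.closedBall_mem_nhds (ω x) hε)] with z hz hz'
      exact ⟨hz, mem_closedBall_iff_norm.1 hz'⟩
    obtain ⟨r, hr, hball⟩ := Metric.eventually_nhds_iff_ball.1 hnear
    filter_upwards [Metric.ball_mem_nhds x hr] with y hy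
    exact hseg x r ε (fun z hz => (hball z hz).1) (fun z hz => (hball z hz).2) y hy
  obtain ⟨x₀, hx₀⟩ := hconn.nonempty
  have hreach : ∀ x ∈ U, ∃ v, HasPathIntegral U ω x₀ x v := fun x hx =>
    hconn.isPreconnected.induction₂ (fun x y => ∃ v, HasPathIntegral U ω x y v)
      (fun x hx => ((hlocal x hx 1 one_pos).filter_mono nhdsWithin_le_nhds).mono
        fun y ⟨v, hv, _⟩ => ⟨v, hv⟩)
      (fun x y z _ _ _ ⟨v, hv⟩ ⟨w, hw⟩ => ⟨v + w, hv.trans hω hw⟩)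
      (fun x y _ _ ⟨v, hv⟩ => ⟨-v, hv.symm⟩) hx₀ hx
  choose! f hf using hreach
  refine ⟨f, fun x hx => .of_isLittleO <| Asymptotics.isLittleO_iff.2 fun c hc => ?_⟩
  filter_upwards [hlocal x hx (c / C) (by positivity), hU.mem_nhds hx] with y ⟨v, hv, hle⟩ hy
  have hzero := hloop _ _ (((hf x hx).trans hω hv).trans hω (hf y hy).symm)
  have hv' : f y - f x = v := by
    rw [sub_eq_iff_eq_add', ← sub_eq_zero, ← neg_eq_zero, ← hzero]; abel
  rw [hv']
  exact hle.trans_eq (by field_simp)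

end


/-- On a nonempty open connected set `U` of a real Banach space `A`, a continuously
differentiable 1-form `ω : A → L(A,B)` is integrable on `U` if and only if the integral
of `ω` along every `C¹` loop contained in `U` vanishes. -/
theorem stmt_17 {A B : Type*} [NormedAddCommGroup A] [NormedSpace ℝ A] [CompleteSpace A]
    [NormedAddCommGroup B] [NormedSpace ℝ B] [CompleteSpace B]
    (U : Set A) (hU : IsOpen U) (hconn : IsConnected U)
    (ω : A → (A →L[ℝ] B)) (ω' : A → (A →L[ℝ] (A →L[ℝ] B)))
    (hω : ∀ x ∈ U, HasFDerivAt ω (ω' x) x)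
    (hω' : ContinuousOn ω' U) :
    (∃ f : A → B, ∀ x ∈ U, HasFDerivAt f (ω x) x) ↔
      (∀ γ γd : ℝ → A, (∀ t : ℝ, HasDerivAt γ (γd t) t) → Continuous γd →
        (∀ t ∈ Set.Icc (0 : ℝ) 1, γ t ∈ U) → γ 0 = γ 1 →
        ∫ t in (0 : ℝ)..1, ω (γ t) (γd t) = 0) := by
  have hωc : ContinuousOn ω U := fun x hx => (hω x hx).continuousAt.continuousWithinAt
  constructor
  · rintro ⟨f, hf⟩ γ γd hγ hγd hmem hloop
    have hsub : Set.uIcc (0 : ℝ) 1 = Set.Icc 0 1 := Set.uIcc_of_le zero_le_one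
    have hγc : Continuous γ := continuous_iff_continuousAt.2 fun t => (hγ t).continuousAt
    rw [intervalIntegral.integral_eq_sub_of_hasDerivAt (f := f ∘ γ)
      (fun t ht => (hf _ (hmem t (hsub ▸ ht))).comp_hasDerivAt t (hγ t)), Function.comp_apply,
      Function.comp_apply, hloop, sub_self]
    refine ContinuousOn.intervalIntegrable ?_
    rw [hsub]
    exact (hωc.comp hγc.continuousOn hmem).clm_apply hγd.continuousOn
  · refine fun h => exists_hasFDerivAt_of_hasPathIntegral_eq_zero hU hconn hωc ?_
    rintro x v ⟨γ, γd, hγ, hγd, hmem, h0, h1, rfl⟩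
    exact h γ γd hγ hγd (fun t _ => hmem t) (by rw [h0 0 le_rfl, h1 1 le_rfl])
end

section
/- Let a, b : ℂ → ℂ be continuously differentiable when ℂ is regarded as a real Banach space, and consider the ℂ-valued differential 1-form ω on ℂ given by ω(z)(h) = a(z)·h + b(z)·conj(h). Then ω is integrable — that is, there exists f : ℂ → ℂ such that for every z ∈ ℂ the real Fréchet derivative of f at z is the map h ↦ a(z)·h + b(z)·conj(h) — if and only if for every z ∈ ℂ: ∂a/∂x⁰(z) + i·∂a/∂x¹(z) − ∂b/∂x⁰(z) + i·∂b/∂x¹(z) = 0, where for g : ℂ → ℂ, ∂g/∂x⁰(z) = Dg(z)(1) and ∂g/∂x¹(z) = Dg(z)(i) denote the partial derivatives of g along 1 and i. -/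
/-- The real-linear 1-form `z ↦ (h ↦ a z * h + b z * conj h)` on `ℂ`. -/
noncomputable def complexOneForm (a b : ℂ → ℂ) (z : ℂ) : ℂ →L[ℝ] ℂ :=
  a z • ContinuousLinearMap.id ℝ ℂ + b z • (Complex.conjCLE : ℂ →L[ℝ] ℂ)

@[simp]
theorem complexOneForm_apply (a b : ℂ → ℂ) (z h : ℂ) :
    complexOneForm a b z h = a z * h + b z * (starRingEnd ℂ) h := by
  simp [complexOneForm]

theorem differentiable_complexOneForm {a b : ℂ → ℂ} (ha : Differentiable ℝ a)
    (hb : Differentiable ℝ b) : Differentiable ℝ (complexOneForm a b) :=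
  (ha.smul_const _).add (hb.smul_const _)

theorem fderiv_complexOneForm_apply {a b : ℂ → ℂ} {z : ℂ} (ha : DifferentiableAt ℝ a z)
    (hb : DifferentiableAt ℝ b z) (u v : ℂ) :
    fderiv ℝ (complexOneForm a b) z u v =
      fderiv ℝ a z u * v + fderiv ℝ b z u * (starRingEnd ℂ) v := by
  have h : HasFDerivAt (complexOneForm a b) _ z :=
    (ha.hasFDerivAt.smul_const (ContinuousLinearMap.id ℝ ℂ)).add
      (hb.hasFDerivAt.smul_const (Complex.conjCLE : ℂ →L[ℝ] ℂ))
  rw [h.fderiv]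
  simp

/-- A real bilinear map on `ℂ` is symmetric as soon as it is symmetric on the pair `(1, I)`. -/
theorem symmetric_of_one_I {B : ℂ →L[ℝ] ℂ →L[ℝ] ℂ} (h : B 1 Complex.I = B Complex.I 1)
    (u v : ℂ) : B u v = B v u := by
  have key (w : ℂ) : w = w.re • (1 : ℂ) + w.im • Complex.I := by
    simp [Complex.re_add_im]
  rw [key u, key v]
  simp only [map_add, map_smul, add_apply, smul_apply, h]
  module

/-- The differential 1-form `ω(z)(h) = a(z)·h + b(z)·conj h` on `ℂ` (regarded as a real
Banach space), with `a, b` continuously differentiable over `ℝ`, is integrable — i.e.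
there exists `f : ℂ → ℂ` whose real Fréchet derivative at every `z` is
`h ↦ a(z)·h + b(z)·conj h` — if and only if
`∂a/∂x⁰ + i·∂a/∂x¹ − ∂b/∂x⁰ + i·∂b/∂x¹ = 0` everywhere, where `∂g/∂x⁰(z) = Dg(z)(1)`
and `∂g/∂x¹(z) = Dg(z)(i)`. -/
theorem stmt_19 (a b : ℂ → ℂ) (ha : ContDiff ℝ 1 a) (hb : ContDiff ℝ 1 b) :
    (∃ f : ℂ → ℂ, ∀ z : ℂ, DifferentiableAt ℝ f z ∧
        ∀ h : ℂ, fderiv ℝ f z h = a z * h + b z * (starRingEnd ℂ) h) ↔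
      (∀ z : ℂ, fderiv ℝ a z 1 + Complex.I * fderiv ℝ a z Complex.I
          - fderiv ℝ b z 1 + Complex.I * fderiv ℝ b z Complex.I = 0) := by
  have hda : Differentiable ℝ a := ha.differentiable one_ne_zero
  have hdb : Differentiable ℝ b := hb.differentiable one_ne_zero
  have hω := differentiable_complexOneForm hda hdb
  constructor
  · rintro ⟨f, hf⟩ z
    have hf' (y : ℂ) : HasFDerivAt f (complexOneForm a b y) y := by
      have h : fderiv ℝ f y = complexOneForm a b y := by
        ext1 h
        rw [(hf y).2 h, complexOneForm_apply]
      exact h ▸ (hf y).1.hasFDerivAt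
    have h := second_derivative_symmetric hf' (hω z).hasFDerivAt 1 Complex.I
    rw [fderiv_complexOneForm_apply (hda z) (hdb z),
      fderiv_complexOneForm_apply (hda z) (hdb z)] at h
    simp only [map_one, Complex.conj_I] at h
    linear_combination -Complex.I * h +
      (fderiv ℝ a z 1 - fderiv ℝ b z 1) * Complex.I_mul_I
  · intro h
    have hsymm (z u v : ℂ) : fderiv ℝ (complexOneForm a b) z u v =
        fderiv ℝ (complexOneForm a b) z v u := by
      refine symmetric_of_one_I ?_ u v
      rw [fderiv_complexOneForm_apply (hda z) (hdb z),
        fderiv_complexOneForm_apply (hda z) (hdb z)]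
      simp only [map_one, Complex.conj_I]
      linear_combination Complex.I * h z -
        (fderiv ℝ a z Complex.I + fderiv ℝ b z Complex.I) * Complex.I_mul_I
    obtain ⟨f, hf⟩ := convex_univ.exists_forall_hasFDerivAt_of_fderiv_symmetric isOpen_univ
      hω.differentiableOn fun z _ u v => hsymm z u v
    refine ⟨f, fun z => ⟨(hf z trivial).differentiableAt, fun h => ?_⟩⟩
    rw [(hf z trivial).fderiv, complexOneForm_apply]
end
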